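/- arXiv:2006.07704 — 2 statements merged into one kernel-verified Lean document; each statement's English description precedes it below -/
import Mathlib

section
/- For all integers n ≥ 0 and k ≥ 1, one has (−1)^{k} ( Q(n) + 2 Σ_{j=1}^{k} (−1)^j Q(n − 3j²) − ε(n) ) ≥ 0, where ε(n) = 1 if n = G_m for some integer m ≥ 0 and ε(n) = 0 otherwise; moreover the inequality is strict if and only if n ≥ 3(k+1)². -/
/-- The `n`-th triangular number `T n = n(n+1)/2`. -/
def T (n : ℕ) : ℕ := n * (n + 1) / 2

/-- The `n`-th generalized pentagonal number `G n = T n - T ⌊n/2⌋`. -/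
def G (n : ℕ) : ℕ := T n - T (n / 2)

/-- The number of partitions of `n` into distinct parts, vanishing on negative integers. -/
def Q (n : ℤ) : ℤ :=
  if 0 ≤ n then ((Nat.Partition.distincts n.toNat).card : ℤ) else 0

open Classical in
/-- `ε(n) = 1` if `n = G m` for some `m ≥ 0`, and `0` otherwise. -/
noncomputable def eps (n : ℕ) : ℤ := if ∃ m, n = G m then 1 else 0

section CommRing

variable {R : Type*} [CommRing R]

/-- The Gaussian binomial coefficient `[n; k]` at `q`, defined by the Pascal recursion. -/
def gaussBinom (q : R) : ℕ → ℕ → R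
  | _, 0 => 1
  | 0, _ + 1 => 0
  | n + 1, k + 1 => gaussBinom q n k + q ^ (k + 1) * gaussBinom q n (k + 1)

/-- The finite `q`-Pochhammer symbol `(q; q)_n`. -/
def qFactor (q : R) (n : ℕ) : R := ∏ i ∈ Finset.range n, (1 - q ^ (i + 1))

lemma gaussBinom_zero_right (q : R) (n : ℕ) : gaussBinom q n 0 = 1 := by
  cases n <;> rfl

lemma gaussBinom_succ_succ (q : R) (n k : ℕ) :
    gaussBinom q (n + 1) (k + 1) = gaussBinom q n k + q ^ (k + 1) * gaussBinom q n (k + 1) := rfl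

lemma gaussBinom_eq_zero_of_lt (q : R) (n k : ℕ) (h : n < k) : gaussBinom q n k = 0 := by
  induction n generalizing k with
  | zero => cases k with
    | zero => omega
    | succ k => rfl
  | succ n ih => cases k with
    | zero => omega
    | succ k => rw [gaussBinom_succ_succ, ih k (by omega), ih (k + 1) (by omega)]; simp

lemma gaussBinom_self (q : R) (n : ℕ) : gaussBinom q n n = 1 := by
  induction n with
  | zero => rfl
  | succ n ih => rw [gaussBinom_succ_succ, ih, gaussBinom_eq_zero_of_lt q n (n + 1) (by omega)]; simp

lemma qFactor_succ (q : R) (n : ℕ) : qFactor q (n + 1) = qFactor q n * (1 - q ^ (n + 1)) :=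
  Finset.prod_range_succ _ _

lemma qFactor_mul_qFactor_mul_gaussBinom (q : R) (k l : ℕ) :
    qFactor q k * qFactor q l * gaussBinom q (k + l) k = qFactor q (k + l) := by
  induction k generalizing l with
  | zero => simp [gaussBinom_zero_right, qFactor]
  | succ k ihk =>
    induction l with
    | zero => simp [gaussBinom_self, qFactor]
    | succ l ihl =>
      have h1 := ihk (l + 1)
      rw [show k + 1 + (l + 1) = (k + l + 1) + 1 by omega, gaussBinom_succ_succ, qFactor_succ q k,
        qFactor_succ q l, qFactor_succ q (k + l + 1)]
      rw [show k + 1 + l = k + l + 1 by omega, qFactor_succ q k] at ihl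
      rw [show k + (l + 1) = k + l + 1 by omega, qFactor_succ q l] at h1
      linear_combination (1 - q ^ (k + 1)) * h1 + q ^ (k + 1) * (1 - q ^ (l + 1)) * ihl

/-- The homogeneous form of the finite `q`-binomial theorem. -/
lemma prod_add_mul_pow_eq_sum (q x y : R) (n : ℕ) :
    ∏ i ∈ Finset.range n, (x + y * q ^ i) =
      ∑ k ∈ Finset.range (n + 1), gaussBinom q n k * q ^ (k.choose 2) * y ^ k * x ^ (n - k) := by
  induction n generalizing y with
  | zero => simp [gaussBinom_zero_right]
  | succ n ih =>
    have h : ∏ i ∈ Finset.range (n + 1), (x + y * q ^ i) =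
        (x + y) * ∏ i ∈ Finset.range n, (x + (y * q) * q ^ i) := by
      rw [Finset.prod_range_succ', mul_comm]
      simp [pow_succ', mul_assoc]
    rw [h, ih, Finset.sum_range_succ' _ (n + 1), add_mul, Finset.mul_sum, Finset.mul_sum]
    have hx : ∑ k ∈ Finset.range (n + 1),
          x * (gaussBinom q n k * q ^ (k.choose 2) * (y * q) ^ k * x ^ (n - k)) =
        ∑ k ∈ Finset.range (n + 1),
          q ^ (k + 1) * gaussBinom q n (k + 1) * q ^ ((k + 1).choose 2) * y ^ (k + 1) * x ^ (n - k)
        + x ^ (n + 1) := by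
      have hs : ∑ k ∈ Finset.range (n + 1),
          x * (gaussBinom q n k * q ^ (k.choose 2) * (y * q) ^ k * x ^ (n - k)) =
          ∑ k ∈ Finset.range (n + 2),
          gaussBinom q n k * q ^ (k.choose 2) * (y * q) ^ k * x ^ (n + 1 - k) := by
        rw [Finset.sum_range_succ _ (n + 1), gaussBinom_eq_zero_of_lt q n (n + 1) (by omega)]
        simp only [zero_mul, add_zero]
        refine Finset.sum_congr rfl fun k hk => ?_
        rw [Finset.mem_range] at hk
        rw [show n + 1 - k = n - k + 1 by omega]
        ring
      rw [hs, Finset.sum_range_succ']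
      congr 1
      · refine Finset.sum_congr rfl fun k hk => ?_
        rw [Nat.add_sub_add_right]
        ring
      · simp [gaussBinom_zero_right]
    rw [hx, add_right_comm, ← Finset.sum_add_distrib]
    congr 1
    · refine Finset.sum_congr rfl fun k hk => ?_
      rw [gaussBinom_succ_succ, Nat.add_sub_add_right, Nat.choose_succ_succ' k 1, Nat.choose_one_right]
      ring
    · simp [gaussBinom_zero_right]

lemma prod_one_sub_pow_odd_mul_qFactor (q : R) (n : ℕ) :
    (∏ i ∈ Finset.range n, (1 - q ^ (2 * i + 1))) * qFactor (q ^ 2) n = qFactor q (2 * n) := by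
  induction n with
  | zero => simp [qFactor]
  | succ n ih =>
    rw [Finset.prod_range_succ, qFactor_succ, show 2 * (n + 1) = 2 * n + 1 + 1 by ring,
      qFactor_succ, qFactor_succ, ← ih]
    ring

lemma prod_one_add_pow_mul_qFactor (q : R) (n : ℕ) :
    (∏ i ∈ Finset.range n, (1 + q ^ (i + 1))) * qFactor q n = qFactor (q ^ 2) n := by
  rw [qFactor, qFactor, ← Finset.prod_mul_distrib]
  exact Finset.prod_congr rfl fun i _ => by ring

lemma prod_range_three_mul (f : ℕ → R) (n : ℕ) :
    ∏ i ∈ Finset.range (3 * n), f i =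
      (∏ i ∈ Finset.range n, f (3 * i + 2)) *
        ∏ i ∈ Finset.range n, (f (3 * i + 1) * f (3 * i)) := by
  induction n with
  | zero => simp
  | succ n ih =>
    rw [show 3 * (n + 1) = 3 * n + 1 + 1 + 1 by ring]
    simp only [Finset.prod_range_succ, ih]
    ring

end CommRing

section PowerSeries

open PowerSeries

lemma X_pow_dvd_prod_range_sub_prod_range (g : ℕ → ℤ⟦X⟧) {M m n : ℕ} (hmn : m ≤ n)
    (hg : ∀ i, m ≤ i → X ^ M ∣ g i - 1) :
    X ^ M ∣ ∏ i ∈ Finset.range n, g i - ∏ i ∈ Finset.range m, g i := by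
  induction n, hmn using Nat.le_induction with
  | base => simp
  | succ n hn ih =>
    rw [Finset.prod_range_succ]
    have := dvd_add ((hg n hn).mul_left (∏ i ∈ Finset.range n, g i)) ih
    convert this using 1
    ring

lemma isUnit_qFactor_X_pow {s : ℕ} (hs : 0 < s) (n : ℕ) : IsUnit (qFactor ((X : ℤ⟦X⟧) ^ s) n) := by
  rw [PowerSeries.isUnit_iff_constantCoeff, qFactor, map_prod, Finset.prod_eq_one]
  · exact isUnit_one
  · intro i _
    simp [hs.ne']

lemma X_pow_dvd_qFactor_sub_qFactor (s : ℕ) {m n : ℕ} (hmn : m ≤ n) :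
    X ^ (s * (m + 1)) ∣ qFactor ((X : ℤ⟦X⟧) ^ s) n - qFactor (X ^ s) m := by
  refine X_pow_dvd_prod_range_sub_prod_range _ hmn fun i hi => ?_
  rw [sub_sub_cancel_left, dvd_neg, ← pow_mul]
  exact pow_dvd_pow _ (Nat.mul_le_mul_left s (by omega))

lemma X_pow_dvd_qFactor_mul_gaussBinom_sub_one {s : ℕ} (hs : 0 < s) {m k l : ℕ} (hk : m ≤ k)
    (hl : m ≤ l) :
    X ^ (s * (m + 1)) ∣
      qFactor ((X : ℤ⟦X⟧) ^ s) (k + l) * gaussBinom (X ^ s) (k + l) k - 1 := by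
  have hu := (isUnit_qFactor_X_pow hs k).mul (isUnit_qFactor_X_pow hs l)
  rw [← hu.dvd_mul_left]
  have h := qFactor_mul_qFactor_mul_gaussBinom ((X : ℤ⟦X⟧) ^ s) k l
  have hP : ∀ t, m ≤ t → t ≤ k + l →
      X ^ (s * (m + 1)) ∣ qFactor ((X : ℤ⟦X⟧) ^ s) (k + l) - qFactor (X ^ s) t := fun t h1 h2 =>
    (pow_dvd_pow _ (Nat.mul_le_mul_left s (by omega))).trans (X_pow_dvd_qFactor_sub_qFactor s h2)
  have h3 := dvd_add ((hP k hk (by omega)).mul_left (qFactor ((X : ℤ⟦X⟧) ^ s) (k + l)))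
    ((hP l hl (by omega)).mul_left (qFactor ((X : ℤ⟦X⟧) ^ s) k))
  convert h3 using 1
  linear_combination qFactor ((X : ℤ⟦X⟧) ^ s) (k + l) * h

/-- The finite Jacobi triple product identity, where `e j = (a + b) * j * (j - 1) / 2 + b * j`. -/
lemma finite_jacobi_triple_product (a b : ℕ) (c : ℤ⟦X⟧) (hc : c * c = 1) (e : ℤ → ℕ)
    (he : ∀ j, 2 * (e j : ℤ) = (a + b) * (j * (j - 1)) + 2 * b * j) (N : ℕ) :
    c ^ N * ∏ i ∈ Finset.range N,
        ((1 + c * X ^ ((a + b) * i + a)) * (1 + c * X ^ ((a + b) * i + b))) =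
      ∑ k ∈ Finset.range (2 * N + 1), gaussBinom (X ^ (a + b)) (2 * N) k * c ^ k *
        X ^ e ((k : ℤ) - N) := by
  rcases Nat.eq_zero_or_pos N with rfl | hN
  · have : e 0 = 0 := by have := he 0; simp at this; exact this
    simp [gaussBinom_zero_right, this]
  obtain ⟨M, rfl⟩ : ∃ M, N = M + 1 := ⟨N - 1, by omega⟩
  set N := M + 1 with hNM
  set d := (a + b) * M + a with hd
  have key := prod_add_mul_pow_eq_sum ((X : ℤ⟦X⟧) ^ (a + b)) (X ^ d) c (2 * N)
  have hL : ∏ i ∈ Finset.range (2 * N), ((X : ℤ⟦X⟧) ^ d + c * (X ^ (a + b)) ^ i) =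
      X ^ ((a + b) * N.choose 2 + d * N) * (c ^ N * ∏ i ∈ Finset.range N,
        ((1 + c * X ^ ((a + b) * i + a)) * (1 + c * X ^ ((a + b) * i + b)))) := by
    rw [two_mul, Finset.prod_range_add, ← Finset.prod_range_reflect]
    have h1 : ∏ i ∈ Finset.range N, ((X : ℤ⟦X⟧) ^ d + c * (X ^ (a + b)) ^ (N - 1 - i)) =
        X ^ ((a + b) * N.choose 2) * (c ^ N *
          ∏ i ∈ Finset.range N, (1 + c * X ^ ((a + b) * i + a))) := by
      have h2 : (X : ℤ⟦X⟧) ^ ((a + b) * N.choose 2) =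
          ∏ i ∈ Finset.range N, (X ^ (a + b)) ^ (N - 1 - i) := by
        rw [Finset.prod_range_reflect (fun i => ((X : ℤ⟦X⟧) ^ (a + b)) ^ i) N,
          Finset.prod_pow_eq_pow_sum, Finset.sum_range_id, ← pow_mul, Nat.choose_two_right]
      have h3 : c ^ N = ∏ i ∈ Finset.range N, c := by simp
      rw [h2, h3, ← Finset.prod_mul_distrib, ← Finset.prod_mul_distrib]
      refine Finset.prod_congr rfl fun i hi => ?_
      rw [Finset.mem_range] at hi
      obtain ⟨t, rfl⟩ : ∃ t, M = i + t := ⟨M - i, by omega⟩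
      rw [show N - 1 - i = t by omega, hd, ← pow_mul,
        show (a + b) * (i + t) + a = (a + b) * t + ((a + b) * i + a) by ring, pow_add X ((a + b) * t)]
      linear_combination (-X ^ ((a + b) * t) * X ^ ((a + b) * i + a)) * hc
    have h4 : ∏ i ∈ Finset.range N, ((X : ℤ⟦X⟧) ^ d + c * (X ^ (a + b)) ^ (N + i)) =
        X ^ (d * N) * ∏ i ∈ Finset.range N, (1 + c * X ^ ((a + b) * i + b)) := by
      have h2 : (X : ℤ⟦X⟧) ^ (d * N) = ∏ i ∈ Finset.range N, X ^ d := by simp [pow_mul]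
      rw [h2, ← Finset.prod_mul_distrib]
      refine Finset.prod_congr rfl fun i hi => ?_
      rw [← pow_mul, show (a + b) * (N + i) = d + ((a + b) * i + b) by rw [hd, hNM]; ring, pow_add]
      ring
    rw [h1, h4, Finset.prod_mul_distrib, pow_add]
    ring
  rw [hL] at key
  refine mul_left_cancel₀ (pow_ne_zero ((a + b) * N.choose 2 + d * N) (X_ne_zero (R := ℤ))) ?_
  rw [key, Finset.mul_sum]
  refine Finset.sum_congr rfl fun k hk => ?_
  rw [Finset.mem_range] at hk
  obtain ⟨l, hl⟩ : ∃ l, 2 * N = k + l := ⟨2 * N - k, by omega⟩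
  have hexp : (a + b) * k.choose 2 + d * (2 * N - k) =
      (a + b) * N.choose 2 + d * N + e ((k : ℤ) - N) := by
    have hch : ∀ t : ℕ, 2 * (t.choose 2 : ℤ) = t * (t - 1) := by
      intro t
      have := Nat.choose_two_right t
      have h2 := Nat.even_mul_pred_self t
      have h3 : 2 * t.choose 2 = t * (t - 1) := by
        rw [this]; exact Nat.mul_div_cancel' h2.two_dvd
      rcases Nat.eq_zero_or_pos t with rfl | ht
      · simp
      · zify [ht] at h3; exact h3
    have h5 := hch k
    have h6 := hch N
    have h7 := he ((k : ℤ) - N)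
    have h8 : (l : ℤ) = 2 * N - k := by omega
    have h9 : (d : ℤ) = (a + b) * (N - 1) + a := by rw [hd, hNM]; push_cast; ring
    rw [show 2 * N - k = l by omega]
    zify
    refine mul_left_cancel₀ (two_ne_zero (α := ℤ)) ?_
    rw [h8, h9]
    linear_combination (a + b : ℤ) * h5 - (a + b : ℤ) * h6 - h7
  have hX : ((X : ℤ⟦X⟧) ^ (a + b)) ^ k.choose 2 * (X ^ d) ^ (2 * N - k) =
      X ^ ((a + b) * N.choose 2 + d * N) * X ^ e ((k : ℤ) - N) := by
    rw [← pow_mul, ← pow_mul, ← pow_add, ← pow_add, hexp]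
  linear_combination gaussBinom ((X : ℤ⟦X⟧) ^ (a + b)) (2 * N) k * c ^ k * hX

/-- The Jacobi triple product identity modulo `X ^ N`. -/
lemma X_pow_dvd_jacobi_triple_product_sub (a b : ℕ) (hab : 0 < a + b) (c : ℤ⟦X⟧) (hc : c * c = 1)
    (e : ℤ → ℕ) (he : ∀ j, 2 * (e j : ℤ) = (a + b) * (j * (j - 1)) + 2 * b * j) (N : ℕ) :
    X ^ N ∣ qFactor (X ^ (a + b)) (2 * N) * ∏ i ∈ Finset.range N,
        ((1 + c * X ^ ((a + b) * i + a)) * (1 + c * X ^ ((a + b) * i + b))) -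
      ∑ k ∈ Finset.range (2 * N + 1), c ^ (N + k) * X ^ e ((k : ℤ) - N) := by
  have hcN : c ^ N * c ^ N = 1 := by rw [← mul_pow, hc, one_pow]
  have h := finite_jacobi_triple_product a b c hc e he N
  set F := ∏ i ∈ Finset.range N,
        ((1 + c * X ^ ((a + b) * i + a)) * (1 + c * X ^ ((a + b) * i + b)))
  have h2 : qFactor (X ^ (a + b)) (2 * N) * F -
      ∑ k ∈ Finset.range (2 * N + 1), c ^ (N + k) * X ^ e ((k : ℤ) - N) =
      ∑ k ∈ Finset.range (2 * N + 1), c ^ (N + k) *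
        ((qFactor (X ^ (a + b)) (2 * N) * gaussBinom (X ^ (a + b)) (2 * N) k - 1) *
          X ^ e ((k : ℤ) - N)) := by
    have h3 : F = c ^ N * (c ^ N * F) := by rw [← mul_assoc, hcN, one_mul]
    rw [h3, h, Finset.mul_sum, Finset.mul_sum, ← Finset.sum_sub_distrib]
    refine Finset.sum_congr rfl fun k _ => ?_
    rw [pow_add]
    ring
  rw [h2]
  refine Finset.dvd_sum fun k hk => Dvd.dvd.mul_left ?_ _
  rw [Finset.mem_range] at hk
  obtain ⟨l, hl⟩ : ∃ l, 2 * N = k + l := ⟨2 * N - k, by omega⟩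
  rw [hl]
  have h4 := mul_dvd_mul (X_pow_dvd_qFactor_mul_gaussBinom_sub_one hab (min_le_left k l)
    (min_le_right k l)) (dvd_refl (X ^ e ((k : ℤ) - N)))
  rw [← pow_add] at h4
  refine (pow_dvd_pow _ ?_).trans h4
  have h5 := he ((k : ℤ) - N)
  generalize e ((k : ℤ) - N) = E at h5 ⊢
  rcases le_total k l with hkl | hkl
  · rw [min_eq_left hkl]
    obtain ⟨t, rfl⟩ : ∃ t, N = k + t := ⟨N - k, by omega⟩
    have h6 : 0 ≤ ((t : ℤ) - 1) * (t - 2) := by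
      rcases t with _ | _ | t
      · norm_num
      · norm_num
      · push_cast
        nlinarith
    push_cast at h5
    zify
    nlinarith [mul_nonneg (Int.natCast_nonneg a) h6, mul_nonneg (Int.natCast_nonneg b) h6,
      mul_nonneg (Int.natCast_nonneg a) (Int.natCast_nonneg t),
      mul_nonneg (show (0 : ℤ) ≤ a + b - 1 by omega) (show (0 : ℤ) ≤ k + t by omega)]
  · rw [min_eq_right hkl]
    obtain ⟨t, rfl⟩ : ∃ t, N = l + t := ⟨N - l, by omega⟩
    obtain rfl : k = l + 2 * t := by omega
    have h6 : 0 ≤ ((t : ℤ) - 1) * (t - 2) := by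
      rcases t with _ | _ | t
      · norm_num
      · norm_num
      · push_cast
        nlinarith
    push_cast at h5
    zify
    nlinarith [mul_nonneg (Int.natCast_nonneg a) h6, mul_nonneg (Int.natCast_nonneg b) h6,
      mul_nonneg (Int.natCast_nonneg b) (Int.natCast_nonneg t),
      mul_nonneg (show (0 : ℤ) ≤ a + b - 1 by omega) (show (0 : ℤ) ≤ l + t by omega)]

/-- The product `∏ (1 + X ^ i)` times the theta series `∑ (-1) ^ j * X ^ (3 * j ^ 2)` is
`∑ X ^ (j * (3 * j - 1) / 2)`, modulo `X ^ N`. -/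
lemma X_pow_dvd_prod_mul_theta_sub (N : ℕ) :
    (X : ℤ⟦X⟧) ^ N ∣ (∏ i ∈ Finset.range (3 * N), (1 + X ^ (i + 1))) *
        ∑ k ∈ Finset.range (2 * N + 1), (-1) ^ (N + k) * X ^ (3 * ((k : ℤ) - N).natAbs ^ 2) -
      ∑ k ∈ Finset.range (2 * N + 1), X ^ pentagonal ((k : ℤ) - N) := by
  have h1 := X_pow_dvd_jacobi_triple_product_sub 2 1 (by norm_num) 1 (by norm_num) pentagonal
    (fun j => by rw [two_mul_natCast_pentagonal]; push_cast; ring) N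
  have h2 := X_pow_dvd_jacobi_triple_product_sub 3 3 (by norm_num) (-1) (by norm_num)
    (fun j => 3 * j.natAbs ^ 2) (fun j => by push_cast; rw [sq_abs]; ring) N
  simp only [one_pow, one_mul, Nat.reduceAdd] at h1 h2
  have h3 := X_pow_dvd_qFactor_sub_qFactor 3 (show N ≤ 2 * N by omega)
  have h4 := X_pow_dvd_qFactor_sub_qFactor 6 (show N ≤ 2 * N by omega)
  replace h3 := (pow_dvd_pow (X : ℤ⟦X⟧) (show N ≤ 3 * (N + 1) by omega)).trans h3
  replace h4 := (pow_dvd_pow (X : ℤ⟦X⟧) (show N ≤ 6 * (N + 1) by omega)).trans h4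
  have h5 := prod_one_sub_pow_odd_mul_qFactor ((X : ℤ⟦X⟧) ^ 3) N
  have h6 := prod_one_add_pow_mul_qFactor ((X : ℤ⟦X⟧) ^ 3) N
  rw [prod_range_three_mul]
  simp only [← pow_mul, Nat.reduceMul] at h5 h6
  have h7 : ∏ i ∈ Finset.range N, (1 + -1 * (X : ℤ⟦X⟧) ^ (6 * i + 3)) * (1 + -1 * X ^ (6 * i + 3)) =
      (∏ i ∈ Finset.range N, (1 - X ^ (3 * (2 * i + 1)))) ^ 2 := by
    rw [← Finset.prod_pow]
    exact Finset.prod_congr rfl fun i _ => by ring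
  rw [h7] at h2
  have h8 : ∏ i ∈ Finset.range N, (1 + (X : ℤ⟦X⟧) ^ (3 * i + 2 + 1)) =
    ∏ i ∈ Finset.range N, (1 + X ^ (3 * (i + 1))) := rfl
  rw [h8]
  rw [← Ideal.mem_span_singleton, ← Ideal.Quotient.eq] at h1 h2 h3 h4 ⊢
  replace h5 := congrArg (Ideal.Quotient.mk (Ideal.span {(X : ℤ⟦X⟧) ^ N})) h5
  replace h6 := congrArg (Ideal.Quotient.mk (Ideal.span {(X : ℤ⟦X⟧) ^ N})) h6
  rw [map_mul] at h1 h2 h5 h6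
  rw [map_pow] at h2
  rw [map_mul, map_mul, ← h1, ← h2]
  generalize Ideal.Quotient.mk (Ideal.span {(X : ℤ⟦X⟧) ^ N}) (∏ i ∈ Finset.range N,
    (1 - X ^ (3 * (2 * i + 1)))) = O at *
  rw [h4] at *
  generalize Ideal.Quotient.mk (Ideal.span {(X : ℤ⟦X⟧) ^ N}) (qFactor (X ^ 6) N) = v at *
  rw [h3] at *
  generalize Ideal.Quotient.mk (Ideal.span {(X : ℤ⟦X⟧) ^ N}) (qFactor (X ^ 3) N) = p at *
  generalize Ideal.Quotient.mk (Ideal.span {(X : ℤ⟦X⟧) ^ N}) (∏ i ∈ Finset.range N,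
    (1 + X ^ (3 * (i + 1)))) = A at *
  generalize Ideal.Quotient.mk (Ideal.span {(X : ℤ⟦X⟧) ^ N}) (∏ i ∈ Finset.range N,
    ((1 + X ^ (3 * i + 2)) * (1 + X ^ (3 * i + 1)))) = B
  linear_combination (A * B * O + B) * h5 + B * O * h6

open scoped PowerSeries.WithPiTopology in
lemma coeff_prod_one_add_X_pow {n M : ℕ} (hn : n < M) :
    coeff n (∏ i ∈ Finset.range M, (1 + (X : ℤ⟦X⟧) ^ (i + 1))) = Q n := by
  have hconst : ∀ m, n < m → ∀ m', m ≤ m' → coeff n (∏ i ∈ Finset.range m', (1 + (X : ℤ⟦X⟧) ^ (i + 1)))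
      = coeff n (∏ i ∈ Finset.range m, (1 + (X : ℤ⟦X⟧) ^ (i + 1))) := by
    intro m hm m' hm'
    have h := X_pow_dvd_prod_range_sub_prod_range (fun i => 1 + (X : ℤ⟦X⟧) ^ (i + 1)) (M := n + 1)
      hm' fun i hi => by rw [add_sub_cancel_left]; exact pow_dvd_pow _ (by omega)
    have := X_pow_dvd_iff.1 h n (by omega)
    rwa [map_sub, sub_eq_zero] at this
  let _ : TopologicalSpace ℤ := ⊥
  have hD : DiscreteTopology ℤ := ⟨rfl⟩
  have h := (Nat.Partition.hasProd_powerSeriesMk_card_countRestricted ℤ two_pos).tendsto_prod_nat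
  rw [WithPiTopology.tendsto_iff_coeff_tendsto] at h
  have h0 : ∀ᶠ m in Filter.atTop, coeff n (∏ i ∈ Finset.range M, (1 + (X : ℤ⟦X⟧) ^ (i + 1))) =
      coeff n (∏ i ∈ Finset.range m, ∑ j ∈ Finset.range 2, (X : ℤ⟦X⟧) ^ ((i + 1) * j)) := by
    filter_upwards [Filter.eventually_ge_atTop M] with m hm
    simp [← hconst M hn m hm, Finset.sum_range_succ]
  have h1 := tendsto_nhds_unique (h n) (tendsto_const_nhds.congr' h0)
  rw [← h1]
  simp [Q, Nat.Partition.countRestricted_two]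

lemma coeff_prod_one_add_X_pow_mul_X_pow {n M : ℕ} (hn : n < M) (d : ℕ) :
    coeff n ((∏ i ∈ Finset.range M, (1 + (X : ℤ⟦X⟧) ^ (i + 1))) * X ^ d) = Q ((n : ℤ) - d) := by
  rw [coeff_mul_X_pow']
  split_ifs with h
  · rw [coeff_prod_one_add_X_pow (by omega), Nat.cast_sub h]
  · rw [Q, if_neg (by omega)]

end PowerSeries

lemma sum_range_two_mul_add_one {A : Type*} [AddCommMonoid A] (f : ℤ → A) (N : ℕ) :
    ∑ k ∈ Finset.range (2 * N + 1), f ((k : ℤ) - N) =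
      f 0 + ∑ j ∈ Finset.Icc 1 N, (f j + f (-j)) := by
  induction N with
  | zero => simp
  | succ N ih =>
    rw [show 2 * (N + 1) + 1 = (2 * N + 1) + 1 + 1 by ring, Finset.sum_range_succ,
      Finset.sum_range_succ', Finset.sum_Icc_succ_top (by omega), ← add_assoc, ← ih]
    have h1 : ((2 * N + 1 + 1 : ℕ) : ℤ) - (N + 1 : ℕ) = (N + 1 : ℕ) := by push_cast; ring
    have h2 : ((0 : ℕ) : ℤ) - (N + 1 : ℕ) = -(N + 1 : ℕ) := by push_cast; ring
    have h3 : ∀ k : ℕ, ((k + 1 : ℕ) : ℤ) - (N + 1 : ℕ) = k - N := fun k => by push_cast; ring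
    simp only [h1, h2, h3]
    rw [add_assoc, add_comm (f (-_))]

lemma exists_eq_G_iff (n : ℕ) : (∃ m, n = G m) ↔ ∃ j : ℤ, pentagonal j = n := by
  have hT : ∀ m, 2 * T m = m * (m + 1) := fun m =>
    Nat.mul_div_cancel' (Nat.even_mul_succ_self m).two_dvd
  have hG0 : ∀ t : ℕ, (G (2 * t) : ℤ) = pentagonal (-t) := by
    intro t
    have h1 := hT (2 * t)
    have h2 := hT t
    have h3 : T t ≤ T (2 * t) := by nlinarith
    have h4 := two_mul_natCast_pentagonal_neg t
    rw [G, show 2 * t / 2 = t by omega, Nat.cast_sub h3]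
    zify at h1 h2
    linarith
  have hG1 : ∀ t : ℕ, (G (2 * t + 1) : ℤ) = pentagonal (t + 1) := by
    intro t
    have h1 := hT (2 * t + 1)
    have h2 := hT t
    have h3 : T t ≤ T (2 * t + 1) := by nlinarith
    have h4 := two_mul_natCast_pentagonal (t + 1)
    rw [G, show (2 * t + 1) / 2 = t by omega, Nat.cast_sub h3]
    zify at h1 h2
    linarith
  constructor
  · rintro ⟨m, rfl⟩
    rcases Nat.even_or_odd' m with ⟨t, rfl | rfl⟩
    · exact ⟨-t, by exact_mod_cast (hG0 t).symm⟩
    · exact ⟨t + 1, by exact_mod_cast (hG1 t).symm⟩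
  · rintro ⟨j, rfl⟩
    rcases le_or_gt j 0 with hj | hj
    · obtain ⟨t, rfl⟩ : ∃ t : ℕ, j = -t := ⟨j.natAbs, by omega⟩
      exact ⟨2 * t, by exact_mod_cast (hG0 t).symm⟩
    · obtain ⟨t, rfl⟩ : ∃ t : ℕ, j = t + 1 := ⟨j.natAbs - 1, by omega⟩
      exact ⟨2 * t + 1, by exact_mod_cast (hG1 t).symm⟩

lemma natAbs_le_pentagonal (j : ℤ) : j.natAbs ≤ pentagonal j := by
  have h := two_mul_natCast_pentagonal j
  zify
  rcases lt_trichotomy j 0 with hj | rfl | hj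
  · rw [abs_of_neg hj]; nlinarith
  · simp
  · rw [abs_of_pos hj]; nlinarith

lemma sum_pentagonal_indicator_eq_eps {n N : ℕ} (h : n ≤ N) :
    ∑ k ∈ Finset.range (2 * N + 1), (if n = pentagonal ((k : ℤ) - N) then (1 : ℤ) else 0) =
      eps n := by
  rw [eps]
  split_ifs with hn
  · obtain ⟨j, rfl⟩ := (exists_eq_G_iff n).1 hn
    have hj := natAbs_le_pentagonal j
    rw [Finset.sum_eq_single_of_mem (j + N).toNat]
    · rw [if_pos]
      congr 1
      omega
    · rw [Finset.mem_range]
      omega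
    · intro k _ hk
      rw [if_neg]
      intro h2
      have := pentagonal_injective h2
      omega
  · refine Finset.sum_eq_zero fun k _ => if_neg fun h2 => hn ?_
    exact (exists_eq_G_iff n).2 ⟨_, h2.symm⟩

/-- The theta function recurrence for partitions into distinct parts. -/
lemma Q_add_two_mul_sum_eq_eps {n N : ℕ} (h : n < N) :
    Q n + 2 * ∑ j ∈ Finset.Icc 1 N, (-1 : ℤ) ^ j * Q ((n : ℤ) - 3 * (j : ℤ) ^ 2) = eps n := by
  have h1 := PowerSeries.X_pow_dvd_iff.1 (X_pow_dvd_prod_mul_theta_sub N) n h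
  rw [map_sub, sub_eq_zero, map_sum] at h1
  simp only [PowerSeries.coeff_X_pow] at h1
  rw [sum_pentagonal_indicator_eq_eps h.le, Finset.mul_sum, map_sum] at h1
  rw [← h1]
  have h2 : ∀ k : ℕ, PowerSeries.coeff n ((∏ i ∈ Finset.range (3 * N),
      (1 + (PowerSeries.X : PowerSeries ℤ) ^ (i + 1))) *
        ((-1) ^ (N + k) * PowerSeries.X ^ (3 * ((k : ℤ) - N).natAbs ^ 2))) =
      (-1) ^ ((k : ℤ) - N).natAbs * Q ((n : ℤ) - 3 * ((k : ℤ) - N) ^ 2) := by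
    intro k
    have h3 : (-1 : ℤ) ^ (N + k) = (-1) ^ ((k : ℤ) - N).natAbs := by
      rw [neg_one_pow_eq_pow_mod_two, neg_one_pow_eq_pow_mod_two (n := ((k : ℤ) - N).natAbs)]
      congr 1
      omega
    have h4 : ((-1) ^ (N + k) : PowerSeries ℤ) = PowerSeries.C ((-1) ^ (N + k)) := by simp
    rw [h4, mul_left_comm, PowerSeries.coeff_C_mul,
      coeff_prod_one_add_X_pow_mul_X_pow (by omega), h3]
    push_cast
    rw [sq_abs]
  simp only [h2]
  rw [sum_range_two_mul_add_one
    (fun j : ℤ => (-1 : ℤ) ^ j.natAbs * Q ((n : ℤ) - 3 * j ^ 2)), Finset.mul_sum]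
  simp [two_mul]

lemma Q_natCast (n : ℕ) : Q n = (Nat.Partition.odds n).card := by
  simp [Q, Nat.Partition.card_odds_eq_card_distincts]

/-- Adjoining a part equal to `1`. -/
def consOne {n : ℕ} (p : n.Partition) : (n + 1).Partition where
  parts := 1 ::ₘ p.parts
  parts_pos := by
    intro i hi
    rcases Multiset.mem_cons.1 hi with rfl | hi
    · exact one_pos
    · exact p.parts_pos hi
  parts_sum := by rw [Multiset.sum_cons, p.parts_sum, add_comm]

lemma consOne_injective (n : ℕ) : Function.Injective (consOne (n := n)) := by
  intro p q h
  have h1 : 1 ::ₘ p.parts = 1 ::ₘ q.parts := congrArg Nat.Partition.parts h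
  exact Nat.Partition.ext ((Multiset.cons_inj_right 1).1 h1)

lemma image_consOne_odds_subset (n : ℕ) :
    (Nat.Partition.odds n).image consOne ⊆ Nat.Partition.odds (n + 1) := by
  intro p hp
  obtain ⟨r, hr, rfl⟩ := Finset.mem_image.1 hp
  simp only [Nat.Partition.odds, Nat.Partition.restricted, Finset.mem_filter, Finset.mem_univ,
    true_and] at hr ⊢
  intro i hi
  rcases Multiset.mem_cons.1 hi with rfl | hi
  · exact Nat.not_even_one
  · exact hr i hi

lemma card_odds_le_succ (n : ℕ) :
    (Nat.Partition.odds n).card ≤ (Nat.Partition.odds (n + 1)).card := by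
  rw [← Finset.card_image_of_injective _ (consOne_injective n)]
  exact Finset.card_le_card (image_consOne_odds_subset n)

lemma card_odds_lt_succ {n : ℕ} (hn : Even n) (h0 : n ≠ 0) :
    (Nat.Partition.odds n).card < (Nat.Partition.odds (n + 1)).card := by
  rw [← Finset.card_image_of_injective _ (consOne_injective n)]
  refine Finset.card_lt_card ((Finset.ssubset_iff_of_subset (image_consOne_odds_subset n)).2
    ⟨Nat.Partition.indiscrete (n + 1), ?_, ?_⟩)
  · simp only [Nat.Partition.odds, Nat.Partition.restricted, Finset.mem_filter, Finset.mem_univ,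
      true_and, Nat.Partition.indiscrete_parts n.succ_ne_zero, Multiset.mem_singleton, forall_eq]
    simpa [Nat.even_add_one] using hn
  · intro h
    obtain ⟨r, _, hr⟩ := Finset.mem_image.1 h
    have h1 : 1 ∈ (Nat.Partition.indiscrete (n + 1)).parts := by
      rw [← hr]
      exact Multiset.mem_cons_self _ _
    rw [Nat.Partition.indiscrete_parts n.succ_ne_zero, Multiset.mem_singleton] at h1
    omega

lemma card_odds_monotone : Monotone fun n => (Nat.Partition.odds n).card :=
  monotone_nat_of_le_succ card_odds_le_succ

lemma Q_of_neg {m : ℤ} (hm : m < 0) : Q m = 0 := if_neg (by omega)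

lemma Q_nonneg (m : ℤ) : 0 ≤ Q m := by
  rw [Q]
  split_ifs <;> positivity

lemma Q_monotone : Monotone Q := by
  intro a b hab
  rcases lt_or_ge a 0 with ha | ha
  · rw [Q_of_neg ha]
    exact Q_nonneg b
  · lift a to ℕ using ha
    lift b to ℕ using by omega
    rw [Q_natCast, Q_natCast]
    exact_mod_cast card_odds_monotone (by exact_mod_cast hab)

lemma Q_pos {m : ℤ} (hm : 0 ≤ m) : 0 < Q m := by
  have h1 : Q 0 = 1 := by decide
  have := Q_monotone hm
  omega

lemma Q_lt_Q_of_add_three_le {a b : ℤ} (hb : 0 ≤ b) (hab : a + 3 ≤ b) : Q a < Q b := by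
  rcases lt_or_ge a 0 with ha | ha
  · rw [Q_of_neg ha]
    exact Q_pos hb
  obtain ⟨t, ht, hat, htb⟩ : ∃ t : ℕ, t ≠ 0 ∧ a ≤ (t + t : ℕ) ∧ ((t + t + 1 : ℕ) : ℤ) ≤ b :=
    ⟨(a.toNat + 2) / 2, by omega, by omega, by omega⟩
  refine (Q_monotone hat).trans_lt (lt_of_lt_of_le ?_ (Q_monotone htb))
  rw [Q_natCast, Q_natCast]
  exact_mod_cast card_odds_lt_succ ⟨t, rfl⟩ (by omega)

lemma alternating_sum_mem_Icc {a : ℕ → ℤ} (ha : Antitone a) (h0 : ∀ i, 0 ≤ a i) (L : ℕ) :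
    ∑ i ∈ Finset.range L, (-1) ^ i * a i ∈ Set.Icc 0 (a 0) := by
  induction L generalizing a with
  | zero => simpa using h0 0
  | succ L ih =>
    have h1 := ih (a := fun i => a (i + 1)) (fun i j hij => ha (by omega)) (fun i => h0 _)
    have h2 := ha (Nat.zero_le 1)
    rw [Finset.sum_range_succ']
    simp only [pow_succ, mul_neg_one, neg_mul, Finset.sum_neg_distrib, pow_zero, one_mul]
    simp only [Set.mem_Icc, zero_add] at h1 ⊢
    constructor <;> linarith

theorem stmt_5 (n k : ℕ) (hk : 1 ≤ k) :
    0 ≤ (-1 : ℤ) ^ k *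
        (Q (n : ℤ) + 2 * ∑ j ∈ Finset.Icc 1 k, (-1 : ℤ) ^ j * Q ((n : ℤ) - 3 * (j : ℤ) ^ 2) - eps n) ∧
    (0 < (-1 : ℤ) ^ k *
        (Q (n : ℤ) + 2 * ∑ j ∈ Finset.Icc 1 k, (-1 : ℤ) ^ j * Q ((n : ℤ) - 3 * (j : ℤ) ^ 2) - eps n) ↔
      3 * (k + 1) ^ 2 ≤ n) := by
  set a : ℕ → ℤ := fun i => Q ((n : ℤ) - 3 * ((k + 1 + i : ℕ) : ℤ) ^ 2) with ha
  have hanti : Antitone a := by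
    intro i j hij
    refine Q_monotone ?_
    gcongr
  have hnonneg : ∀ i, 0 ≤ a i := fun i => Q_nonneg _
  have htail : (-1 : ℤ) ^ k * (Q (n : ℤ) +
      2 * ∑ j ∈ Finset.Icc 1 k, (-1 : ℤ) ^ j * Q ((n : ℤ) - 3 * (j : ℤ) ^ 2) - eps n) =
      2 * ∑ i ∈ Finset.range (n + 2), (-1) ^ i * a i := by
    have hsum : ∀ L, ∑ j ∈ Finset.Icc 1 (k + L), (-1 : ℤ) ^ j * Q ((n : ℤ) - 3 * (j : ℤ) ^ 2) =
        ∑ j ∈ Finset.Icc 1 k, (-1 : ℤ) ^ j * Q ((n : ℤ) - 3 * (j : ℤ) ^ 2) -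
          (-1) ^ k * ∑ i ∈ Finset.range L, (-1) ^ i * a i := by
      intro L
      induction L with
      | zero => simp
      | succ L ih =>
        have haL : Q ((n : ℤ) - 3 * ((k + L + 1 : ℕ) : ℤ) ^ 2) = a L := by
          rw [ha, add_right_comm]
        rw [← add_assoc, Finset.sum_Icc_succ_top (by omega), ih, Finset.sum_range_succ, haL]
        ring
    have hfull := Q_add_two_mul_sum_eq_eps (n := n) (N := k + (n + 2)) (by omega)
    rw [hsum] at hfull
    have hsq : (-1 : ℤ) ^ k * (-1) ^ k = 1 := by rw [← mul_pow]; simp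
    rw [← hfull]
    linear_combination 2 * (∑ i ∈ Finset.range (n + 2), (-1) ^ i * a i) * hsq
  rw [htail]
  have h0 := alternating_sum_mem_Icc hanti hnonneg (n + 2)
  refine ⟨by linarith [h0.1], fun hpos => ?_, fun hn => ?_⟩
  · by_contra! hlt
    have : a 0 = 0 := Q_of_neg (by zify at hlt; push_cast; linarith)
    linarith [h0.2]
  · have h1 := alternating_sum_mem_Icc (a := fun i => a (i + 1)) (fun i j hij => hanti (by omega))
      (fun i => hnonneg _) (n + 1)
    have h2 : a 1 < a 0 := by
      refine Q_lt_Q_of_add_three_le ?_ ?_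
      · zify at hn
        push_cast
        linarith
      · push_cast
        nlinarith
    rw [Finset.sum_range_succ']
    simp only [pow_succ, mul_neg_one, neg_mul, Finset.sum_neg_distrib, pow_zero, one_mul]
    simp only [Set.mem_Icc, zero_add] at h1
    linarith [h1.2]
end

section
/- For every integer n ≥ 0, Q(n) + 2 Σ_{j=1}^{∞} (−1)^j Q(n − 3j²) equals 1 if n = G_m for some integer m ≥ 0, and equals 0 otherwise; the sum is finite since Q vanishes on negative arguments. -/
open Finset PowerSeries
open scoped PowerSeries.WithPiTopology

section FiniteTripleProduct

variable {R : Type*} [CommRing R]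

/-- The finite product `(1 - p)(1 - p²)⋯(1 - pᵏ)`. -/
def qFactorial (p : R) (k : ℕ) : R := ∏ i ∈ range k, (1 - p ^ (i + 1))

/-- For `j ≤ n`, the coefficient `(p;p)ₙ (p;p)₂ₙ / ((p;p)ₙ₋ⱼ (p;p)ₙ₊ⱼ)`, written as a product. -/
def tripleCoeff (p : R) (n j : ℕ) : R :=
  (∏ i ∈ range j, (1 - p ^ (n - i))) * ∏ i ∈ range (n - j), (1 - p ^ (n + j + 1 + i))

/-- The sum of the two theta terms of index `j` and `-j`. -/
def thetaTerm (x y : R) (j : ℕ) : R := (x * y) ^ j.choose 2 * (x ^ j + y ^ j)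

/-- The finite triple product in two variables. -/
def tripleProd (x y : R) (n : ℕ) : R :=
  ∏ k ∈ range n,
    ((1 + x ^ (k + 1) * y ^ k) * (1 + x ^ k * y ^ (k + 1)) * (1 - (x * y) ^ (k + 1)))

lemma qFactorial_succ (p : R) (k : ℕ) :
    qFactorial p (k + 1) = qFactorial p k * (1 - p ^ (k + 1)) :=
  prod_range_succ _ _

lemma tripleCoeff_mul_qFactorial (p : R) (m j : ℕ) :
    tripleCoeff p (m + j) j * (qFactorial p m * qFactorial p (m + 2 * j)) =
      qFactorial p (m + j) * qFactorial p (2 * (m + j)) := by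
  have h₁ : qFactorial p m * ∏ i ∈ range j, (1 - p ^ (m + j - i)) = qFactorial p (m + j) := by
    rw [qFactorial, qFactorial, prod_range_add, ← prod_range_reflect (fun i => 1 - p ^ (m + j - i))]
    congr 1
    refine prod_congr rfl fun i hi => ?_
    have := mem_range.1 hi
    congr 2
    omega
  have h₂ : qFactorial p (m + 2 * j) * ∏ i ∈ range m, (1 - p ^ (m + j + j + 1 + i)) =
      qFactorial p (2 * (m + j)) := by
    rw [show 2 * (m + j) = m + 2 * j + m by ring, qFactorial, qFactorial, prod_range_add _ (m + 2 * j)]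
    congr 1
    refine prod_congr rfl fun i _ => ?_
    congr 2
    ring
  rw [tripleCoeff, Nat.add_sub_cancel, ← h₁, ← h₂]
  ring

lemma tripleCoeff_self_succ (p : R) (n : ℕ) : tripleCoeff p n (n + 1) = 0 := by
  simp [tripleCoeff, prod_range_succ]

lemma tripleCoeff_succ_mul_qFactorial (p : R) (m j : ℕ) :
    tripleCoeff p (m + j) (j + 1) * (qFactorial p (m + 1) * qFactorial p (m + 2 * j + 1)) =
      (1 - p ^ m) * (1 - p ^ (m + 1)) * (qFactorial p (m + j) * qFactorial p (2 * (m + j))) := by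
  cases m with
  | zero => simp [tripleCoeff_self_succ]
  | succ m =>
    have h := tripleCoeff_mul_qFactorial p m (j + 1)
    rw [show m + 1 + j = m + (j + 1) by ring, ← h, qFactorial_succ p (m + 1), qFactorial_succ p m,
      show m + 1 + 2 * j + 1 = m + 2 * (j + 1) by ring]
    ring

lemma tripleCoeff_self_self_succ (p : R) (n : ℕ) :
    tripleCoeff p (n + 1) (n + 1) = (1 - p ^ (n + 1)) * tripleCoeff p n n := by
  simp [tripleCoeff, prod_range_succ', mul_comm]

lemma tripleCoeff_succ_zero [IsDomain R] {p : R} (hp : ∀ k, qFactorial p k ≠ 0) (n : ℕ) :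
    tripleCoeff p (n + 1) 0 = (1 - p ^ (n + 1)) *
      ((1 + p ^ (2 * n + 1)) * tripleCoeff p n 0 + 2 * p ^ (n + 1) * tripleCoeff p n 1) := by
  apply mul_right_cancel₀ (mul_ne_zero (hp (n + 1)) (hp (n + 1)))
  have h₁ := tripleCoeff_mul_qFactorial p (n + 1) 0
  have h₂ := tripleCoeff_mul_qFactorial p n 0
  have h₃ := tripleCoeff_succ_mul_qFactorial p n 0
  simp only [add_zero, mul_zero, zero_add, mul_add, mul_one, qFactorial_succ,
    show 2 * n + 2 = 2 * n + 1 + 1 by ring] at h₁ h₂ h₃ ⊢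
  linear_combination h₁ - (1 - p ^ (n + 1)) ^ 3 * (1 + p ^ (2 * n + 1)) * h₂
    - (1 - p ^ (n + 1)) * 2 * p ^ (n + 1) * h₃

lemma tripleCoeff_succ_succ [IsDomain R] {p : R} (hp : ∀ k, qFactorial p k ≠ 0) (m j : ℕ) :
    tripleCoeff p (m + (j + 1) + 1) (j + 1) = (1 - p ^ (m + (j + 1) + 1)) *
      ((1 + p ^ (2 * (m + (j + 1)) + 1)) * tripleCoeff p (m + (j + 1)) (j + 1) +
        p ^ (m + 1) * tripleCoeff p (m + (j + 1)) j +
        p ^ (m + 2 * j + 3) * tripleCoeff p (m + (j + 1)) (j + 2)) := by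
  apply mul_right_cancel₀ (mul_ne_zero (hp (m + 1)) (hp (m + 2 * (j + 1) + 1)))
  have h₁ := tripleCoeff_mul_qFactorial p (m + 1) (j + 1)
  have h₂ := tripleCoeff_mul_qFactorial p m (j + 1)
  have h₃ := tripleCoeff_succ_mul_qFactorial p m (j + 1)
  have h₄ := tripleCoeff_mul_qFactorial p (m + 1) j
  rw [show m + 1 + (j + 1) = m + (j + 1) + 1 by ring,
    show m + 1 + 2 * (j + 1) = m + 2 * j + 1 + 1 + 1 by ring,
    show 2 * (m + (j + 1) + 1) = 2 * (m + (j + 1)) + 1 + 1 by ring] at h₁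
  rw [show m + 2 * (j + 1) = m + 2 * j + 1 + 1 by ring] at h₂ h₃
  rw [show m + 1 + j = m + (j + 1) by ring, show m + 1 + 2 * j = m + 2 * j + 1 by ring] at h₄
  rw [show m + 2 * (j + 1) = m + 2 * j + 1 + 1 by ring]
  simp only [show j + 1 + 1 = j + 2 by ring] at h₃
  generalize tripleCoeff p (m + (j + 1) + 1) (j + 1) = a₁ at *
  generalize tripleCoeff p (m + (j + 1)) (j + 1) = a₂ at *
  generalize tripleCoeff p (m + (j + 1)) (j + 2) = a₃ at *
  generalize tripleCoeff p (m + (j + 1)) j = a₄ at *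
  simp only [qFactorial_succ p (m + (j + 1)), qFactorial_succ p (2 * (m + (j + 1)) + 1),
    qFactorial_succ p (2 * (m + (j + 1))), qFactorial_succ p (m + 2 * j + 1 + 1),
    qFactorial_succ p (m + 2 * j + 1), qFactorial_succ p m] at h₁ h₂ h₃ h₄ ⊢
  generalize qFactorial p (m + (j + 1)) = e₁ at *
  generalize qFactorial p (2 * (m + (j + 1))) = e₂ at *
  generalize qFactorial p (m + 2 * j + 1) = e₃ at *
  generalize qFactorial p m = e₄ at *
  linear_combination h₁
    - (1 - p ^ (m + (j + 1) + 1)) * (1 + p ^ (2 * (m + (j + 1)) + 1)) * (1 - p ^ (m + 1)) *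
      (1 - p ^ (m + 2 * j + 1 + 1 + 1)) * h₂
    - (1 - p ^ (m + (j + 1) + 1)) * p ^ (m + 2 * j + 3) * h₃
    - (1 - p ^ (m + (j + 1) + 1)) * p ^ (m + 1) * (1 - p ^ (m + 2 * j + 1 + 1)) *
      (1 - p ^ (m + 2 * j + 1 + 1 + 1)) * h₄

lemma thetaTerm_recurrence (x y : R) (j : ℕ) :
    (x * y) ^ (j + 1) * (x + y) * thetaTerm x y (j + 1) =
      thetaTerm x y (j + 2) + (x * y) ^ (2 * (j + 1)) * thetaTerm x y j := by
  simp only [thetaTerm, Nat.choose_succ_succ' _ 1, Nat.choose_one_right]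
  ring

lemma tripleCoeff_partial_sum [IsDomain R] {x y : R} (hp : ∀ k, qFactorial (x * y) k ≠ 0)
    (M m : ℕ) :
    tripleCoeff (x * y) (m + M + 1) 0 +
        ∑ j ∈ range M, tripleCoeff (x * y) (m + M + 1) (j + 1) * thetaTerm x y (j + 1) =
      (1 - (x * y) ^ (m + M + 1)) *
        ((1 + (x * y) ^ (2 * (m + M) + 1) + (x * y) ^ (m + M) * (x + y)) *
          (tripleCoeff (x * y) (m + M) 0 +
            ∑ j ∈ range M, tripleCoeff (x * y) (m + M) (j + 1) * thetaTerm x y (j + 1)) +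
          (x * y) ^ (m + M + 1 + M) * tripleCoeff (x * y) (m + M) (M + 1) * thetaTerm x y M -
          (x * y) ^ m * tripleCoeff (x * y) (m + M) M * thetaTerm x y (M + 1)) := by
  induction M generalizing m with
  | zero =>
    simp only [add_zero, zero_add, range_zero, sum_empty, tripleCoeff_succ_zero hp, thetaTerm,
      pow_zero, pow_one, Nat.choose_eq_zero_of_lt,
      Nat.one_lt_ofNat, Nat.ofNat_pos]
    ring
  | succ M ih =>
    have h := ih (m + 1)
    have hr := tripleCoeff_succ_succ hp m M
    have ht := thetaTerm_recurrence x y M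
    rw [show m + 1 + M = m + (M + 1) by ring] at h
    rw [sum_range_succ, sum_range_succ, ← add_assoc (tripleCoeff (x * y) (m + (M + 1) + 1) 0), h, hr]
    simp only [show M + 1 + 1 = M + 2 by ring] at ht ⊢
    linear_combination (1 - (x * y) ^ (m + (M + 1) + 1)) * (x * y) ^ m *
      tripleCoeff (x * y) (m + (M + 1)) (M + 1) * (-ht)

/-- The finite form of the Jacobi triple product identity. -/
theorem tripleProd_eq_sum [IsDomain R] {x y : R} (hp : ∀ k, qFactorial (x * y) k ≠ 0) (n : ℕ) :
    tripleProd x y n = tripleCoeff (x * y) n 0 +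
      ∑ j ∈ range n, tripleCoeff (x * y) n (j + 1) * thetaTerm x y (j + 1) := by
  induction n with
  | zero => simp [tripleProd, tripleCoeff]
  | succ n ih =>
    have h := tripleCoeff_partial_sum hp n 0
    simp only [zero_add] at h
    rw [sum_range_succ, ← add_assoc, h, tripleCoeff_self_succ, tripleCoeff_self_self_succ, ← ih,
      tripleProd, tripleProd, prod_range_succ]
    ring

lemma pow_dvd_prod_sub_one {ι : Type*} (p : R) (a : ℕ) (s : Finset ι) (e : ι → ℕ)
    (he : ∀ i ∈ s, a ≤ e i) : p ^ a ∣ ∏ i ∈ s, (1 - p ^ e i) - 1 := by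
  induction s using Finset.cons_induction with
  | empty => simp
  | cons i s hi ih =>
    rw [prod_cons]
    obtain ⟨c, hc⟩ := ih fun k hk => he k (mem_cons_of_mem hk)
    obtain ⟨d, hd⟩ := pow_dvd_pow p (he i (mem_cons_self i s))
    exact ⟨(1 - p ^ e i) * c - d, by linear_combination (1 - p ^ e i) * hc - hd⟩

lemma pow_dvd_tripleCoeff_sub_one (p : R) (n j : ℕ) :
    p ^ (n + 1 - j) ∣ tripleCoeff p n j - 1 := by
  obtain ⟨c, hc⟩ := pow_dvd_prod_sub_one p (n + 1 - j) (range j) (fun i => n - i) (by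
    intro i hi
    have := mem_range.1 hi
    omega)
  obtain ⟨d, hd⟩ := pow_dvd_prod_sub_one p (n + 1 - j) (range (n - j)) (fun i => n + j + 1 + i)
    (by intros; omega)
  rw [tripleCoeff]
  exact ⟨c * (∏ i ∈ range (n - j), (1 - p ^ (n + j + 1 + i))) + d, by
    linear_combination hc * (∏ i ∈ range (n - j), (1 - p ^ (n + j + 1 + i))) + hd⟩

lemma self_le_choose_two_succ (j : ℕ) : j ≤ (j + 1).choose 2 := by
  rw [Nat.choose_succ_succ' _ 1, Nat.choose_one_right]
  omega

/-- The Jacobi triple product identity modulo `(xy)ⁿ`. -/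
theorem pow_dvd_tripleProd_sub [IsDomain R] {x y : R} (hp : ∀ k, qFactorial (x * y) k ≠ 0)
    (n : ℕ) :
    (x * y) ^ n ∣ tripleProd x y n - (1 + ∑ j ∈ range n, thetaTerm x y (j + 1)) := by
  have h : tripleProd x y n - (1 + ∑ j ∈ range n, thetaTerm x y (j + 1)) =
      (tripleCoeff (x * y) n 0 - 1) +
        ∑ j ∈ range n, (tripleCoeff (x * y) n (j + 1) - 1) * thetaTerm x y (j + 1) := by
    simp only [tripleProd_eq_sum hp, sub_mul, one_mul, sum_sub_distrib]
    ring
  rw [h]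
  refine dvd_add ((pow_dvd_pow _ (by omega)).trans (pow_dvd_tripleCoeff_sub_one _ n 0))
    (dvd_sum fun j hj => ?_)
  have := mem_range.1 hj
  have := self_le_choose_two_succ j
  refine (pow_dvd_pow _ (show n ≤ (n + 1 - (j + 1)) + (j + 1).choose 2 by omega)).trans ?_
  rw [pow_add]
  exact mul_dvd_mul (pow_dvd_tripleCoeff_sub_one _ n (j + 1)) (Dvd.intro _ rfl)

end FiniteTripleProduct

lemma qFactorial_X_pow_ne_zero (d k : ℕ) : qFactorial ((X : ℤ⟦X⟧) ^ (d + 1)) k ≠ 0 := by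
  intro h
  have := congrArg constantCoeff h
  simp [qFactorial] at this

lemma coeff_prod_one_add_X_pow_eventually_eq (N : ℕ) :
    ∀ᶠ M in Filter.atTop, coeff N (∏ i ∈ range M, (1 + (X : ℤ⟦X⟧) ^ (i + 1))) = Q N := by
  let : TopologicalSpace ℤ := ⊥
  have : DiscreteTopology ℤ := ⟨rfl⟩
  have h := Nat.Partition.hasProd_powerSeriesMk_card_countRestricted ℤ (m := 2) (by omega)
  simp only [sum_range_succ, range_zero, sum_empty, zero_add, mul_zero, pow_zero, mul_one] at h
  rw [HasProd, PowerSeries.WithPiTopology.tendsto_iff_coeff_tendsto] at h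
  have h' := (h N).comp Filter.tendsto_finset_range
  rw [nhds_discrete, Filter.tendsto_pure] at h'
  filter_upwards [h'] with M hM
  simpa [Q, Nat.Partition.countRestricted_two] using hM

lemma X_pow_dvd_distinct_sub_eventually (N : ℕ) :
    ∀ᶠ M in Filter.atTop, (X : ℤ⟦X⟧) ^ N ∣
      PowerSeries.mk (fun n => Q n) - ∏ i ∈ range M, (1 + (X : ℤ⟦X⟧) ^ (i + 1)) := by
  have h : ∀ᶠ M in Filter.atTop, ∀ k ∈ range N,
      coeff k (∏ i ∈ range M, (1 + (X : ℤ⟦X⟧) ^ (i + 1))) = Q k :=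
    (Filter.eventually_all_finset _).2 fun k _ => coeff_prod_one_add_X_pow_eventually_eq k
  filter_upwards [h] with M hM
  rw [X_pow_dvd_iff]
  intro k hk
  simp [hM k (mem_range.2 hk)]

lemma prod_one_add_mul_qFactorial {R : Type*} [CommRing R] (y : R) (n : ℕ) :
    (∏ k ∈ range n, (1 + y ^ (k + 1))) * qFactorial y n = qFactorial (y ^ 2) n := by
  rw [qFactorial, qFactorial, ← prod_mul_distrib]
  exact prod_congr rfl fun k _ => by ring

lemma prod_range_mul {M : Type*} [CommMonoid M] (f : ℕ → M) (d n : ℕ) :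
    ∏ i ∈ range (d * n), f i = ∏ i ∈ range n, ∏ r ∈ range d, f (d * i + r) := by
  induction n with
  | zero => simp
  | succ n ih => rw [mul_add_one, prod_range_add, ih, prod_range_succ]

/-- Gauss's product `∏ (1 - yᵏ) / (1 + yᵏ)` as a triple product, in finite form. -/
lemma prod_one_add_mul_tripleProd {R : Type*} [CommRing R] (y : R) (n : ℕ) :
    (∏ k ∈ range (2 * n), (1 + y ^ (k + 1))) * tripleProd (-y) (-y) n =
      qFactorial y (2 * n) * ∏ k ∈ range n, (1 - (y ^ 2) ^ (n + k + 1)) := by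
  set O := ∏ k ∈ range n, (1 - y ^ (2 * k + 1)) with hO
  have h₁ : qFactorial y (2 * n) = O * qFactorial (y ^ 2) n := by
    rw [qFactorial, prod_range_mul, qFactorial, hO, ← prod_mul_distrib]
    exact prod_congr rfl fun k _ => by simp only [prod_range_succ, prod_range_zero, one_mul]; ring
  have h₂ : tripleProd (-y) (-y) n = O * qFactorial y (2 * n) := by
    rw [h₁, tripleProd, qFactorial, hO, ← prod_mul_distrib, ← prod_mul_distrib]
    refine prod_congr rfl fun k _ => ?_
    have : (-y) ^ (k + 1) * (-y) ^ k = - y ^ (2 * k + 1) := by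
      rw [← pow_add, Odd.neg_pow ⟨k, by ring⟩]
      ring_nf
    rw [mul_comm ((-y) ^ k), this]
    ring
  have h₃ : qFactorial (y ^ 2) (2 * n) =
      qFactorial (y ^ 2) n * ∏ k ∈ range n, (1 - (y ^ 2) ^ (n + k + 1)) := by
    rw [two_mul, qFactorial, prod_range_add, ← qFactorial]
  have h₄ := prod_one_add_mul_qFactorial y (2 * n)
  rw [h₂, h₁]
  rw [h₃] at h₄
  rw [h₁] at h₄
  linear_combination O * h₄

lemma prod_one_add_X_pow_mul_qFactorial (n : ℕ) :
    (∏ i ∈ range (3 * n), (1 + (X : ℤ⟦X⟧) ^ (i + 1))) * qFactorial (X ^ 3) n =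
      (∏ k ∈ range n, (1 + (X ^ 3) ^ (k + 1))) * tripleProd X (X ^ 2) n := by
  rw [prod_range_mul, qFactorial, tripleProd, ← prod_mul_distrib, ← prod_mul_distrib]
  exact prod_congr rfl fun k _ => by simp [prod_range_succ]; ring

lemma prod_one_add_X_pow_mul_tripleProd (n : ℕ) :
    (∏ i ∈ range (6 * n), (1 + (X : ℤ⟦X⟧) ^ (i + 1))) * tripleProd (-X ^ 3) (-X ^ 3) n =
      tripleProd X (X ^ 2) (2 * n) * ∏ k ∈ range n, (1 - ((X ^ 3) ^ 2) ^ (n + k + 1)) := by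
  have hq : ∀ k, qFactorial (X ^ 3 : ℤ⟦X⟧) k ≠ 0 := qFactorial_X_pow_ne_zero 2
  apply mul_right_cancel₀ (hq (2 * n))
  have h₁ := prod_one_add_X_pow_mul_qFactorial (2 * n)
  have h₂ := prod_one_add_mul_tripleProd (X ^ 3 : ℤ⟦X⟧) n
  rw [show 3 * (2 * n) = 6 * n by ring] at h₁
  linear_combination tripleProd (-X ^ 3) (-X ^ 3) n * h₁ + tripleProd X (X ^ 2) (2 * n) * h₂

lemma X_pow_dvd_distinct_mul_theta_sub (N : ℕ) :
    ∃ n, N ≤ n ∧ (X : ℤ⟦X⟧) ^ N ∣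
      PowerSeries.mk (fun n => Q n) * (1 + ∑ j ∈ range n, thetaTerm (-X ^ 3) (-X ^ 3) (j + 1)) -
        (1 + ∑ j ∈ range (2 * n), thetaTerm X (X ^ 2) (j + 1)) := by
  obtain ⟨M, hM⟩ := Filter.eventually_atTop.1 (X_pow_dvd_distinct_sub_eventually N)
  refine ⟨N + M, by omega, ?_⟩
  set n := N + M with hn
  have hD := hM (6 * n) (by omega)
  have hB : (X : ℤ⟦X⟧) ^ N ∣ tripleProd (-X ^ 3) (-X ^ 3) n -
      (1 + ∑ j ∈ range n, thetaTerm (-X ^ 3) (-X ^ 3) (j + 1)) := by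
    have e : (-X ^ 3 : ℤ⟦X⟧) * (-X ^ 3) = X ^ (5 + 1) := by ring
    refine Dvd.dvd.trans ?_ (pow_dvd_tripleProd_sub (e ▸ qFactorial_X_pow_ne_zero 5) n)
    rw [e, ← pow_mul]
    exact pow_dvd_pow _ (by omega)
  have hA : (X : ℤ⟦X⟧) ^ N ∣ tripleProd X (X ^ 2) (2 * n) -
      (1 + ∑ j ∈ range (2 * n), thetaTerm X (X ^ 2) (j + 1)) := by
    have e : (X : ℤ⟦X⟧) * X ^ 2 = X ^ (2 + 1) := by ring
    refine Dvd.dvd.trans ?_ (pow_dvd_tripleProd_sub (e ▸ qFactorial_X_pow_ne_zero 2) (2 * n))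
    rw [e, ← pow_mul]
    exact pow_dvd_pow _ (by omega)
  have hR : (X : ℤ⟦X⟧) ^ N ∣ ∏ k ∈ range n, (1 - ((X ^ 3) ^ 2) ^ (n + k + 1)) - 1 := by
    simp only [← pow_mul]
    exact pow_dvd_prod_sub_one X N _ (fun k => 3 * 2 * (n + k + 1)) (by intros; omega)
  have hP := prod_one_add_X_pow_mul_tripleProd n
  obtain ⟨a, ha⟩ := hD
  obtain ⟨b, hb⟩ := hB
  obtain ⟨c, hc⟩ := hA
  obtain ⟨d, hd⟩ := hR
  generalize 1 + ∑ j ∈ range n, thetaTerm (-X ^ 3 : ℤ⟦X⟧) (-X ^ 3) (j + 1) = Θ at *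
  generalize ∏ i ∈ range (6 * n), (1 + (X : ℤ⟦X⟧) ^ (i + 1)) = P at *
  exact ⟨a * Θ - P * b + tripleProd X (X ^ 2) (2 * n) * d + c, by
    linear_combination Θ * ha - P * hb + hP + tripleProd X (X ^ 2) (2 * n) * hd + hc⟩

lemma two_mul_choose_two_succ (j : ℕ) : 2 * (j + 1).choose 2 = j * (j + 1) := by
  rw [Nat.choose_two_right, Nat.mul_div_cancel' (Nat.even_mul_pred_self _).two_dvd]
  simp [mul_comm]

lemma two_mul_T (n : ℕ) : 2 * T n = n * (n + 1) :=
  Nat.mul_div_cancel' (Nat.even_mul_succ_self n).two_dvd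

lemma thetaTerm_neg_X_pow (j : ℕ) :
    thetaTerm (-X ^ 3 : ℤ⟦X⟧) (-X ^ 3) (j + 1) =
      C (2 * (-1) ^ (j + 1)) * X ^ (3 * (j + 1) ^ 2) := by
  have h := two_mul_choose_two_succ j
  have e : 3 * (j + 1) ^ 2 = 6 * (j + 1).choose 2 + 3 * (j + 1) := by nlinarith
  rw [e, thetaTerm, neg_mul_neg, ← pow_add, ← pow_mul, neg_pow, ← pow_mul, pow_add]
  simp only [map_mul, map_pow, map_neg, map_one, map_ofNat]
  ring

lemma T_succ (n : ℕ) : T (n + 1) = T n + (n + 1) := by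
  have h₁ := two_mul_T n
  have h₂ := two_mul_T (n + 1)
  apply Nat.eq_of_mul_eq_mul_left two_pos
  linear_combination h₂ - h₁

lemma T_mono : Monotone T := monotone_nat_of_le_succ fun n => by rw [T_succ]; omega

lemma G_add_T_half (n : ℕ) : G n + T (n / 2) = T n :=
  Nat.sub_add_cancel (T_mono (Nat.div_le_self n 2))

lemma G_strictMono : StrictMono G := by
  refine strictMono_nat_of_lt_succ fun n => ?_
  have h₁ := G_add_T_half n
  have h₂ := G_add_T_half (n + 1)
  rw [T_succ] at h₂
  obtain ⟨k, rfl | rfl⟩ := n.even_or_odd'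
  · rw [show 2 * k / 2 = k by omega] at h₁
    rw [show (2 * k + 1) / 2 = k by omega] at h₂
    omega
  · rw [show (2 * k + 1) / 2 = k by omega] at h₁
    rw [show (2 * k + 1 + 1) / 2 = k + 1 by omega, T_succ k] at h₂
    omega

lemma thetaTerm_X (j : ℕ) :
    thetaTerm (X : ℤ⟦X⟧) (X ^ 2) (j + 1) = X ^ G (2 * j + 1) + X ^ G (2 * j + 2) := by
  have hc := two_mul_choose_two_succ j
  have h₁ := G_add_T_half (2 * j + 1)
  have h₂ := G_add_T_half (2 * j + 2)
  rw [show (2 * j + 1) / 2 = j by omega] at h₁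
  rw [show (2 * j + 2) / 2 = j + 1 by omega] at h₂
  have t₁ := two_mul_T (2 * j + 1)
  have t₂ := two_mul_T (2 * j + 2)
  have t₃ := two_mul_T j
  have t₄ := two_mul_T (j + 1)
  have e₁ : G (2 * j + 1) = 3 * (j + 1).choose 2 + (j + 1) := by nlinarith
  have e₂ : G (2 * j + 2) = 3 * (j + 1).choose 2 + 2 * (j + 1) := by nlinarith
  rw [e₁, e₂, thetaTerm]
  ring

lemma theta_eq_sum_X_pow_G (n : ℕ) :
    1 + ∑ j ∈ range n, thetaTerm (X : ℤ⟦X⟧) (X ^ 2) (j + 1) =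
      ∑ m ∈ range (2 * n + 1), X ^ G m := by
  induction n with
  | zero => simp [G, T]
  | succ n ih =>
    rw [sum_range_succ, ← add_assoc, ih, thetaTerm_X, mul_add_one, sum_range_succ _ (2 * n + 2),
      sum_range_succ _ (2 * n + 1), add_assoc]

lemma coeff_sum_X_pow_G {N n : ℕ} (h : N < n) :
    coeff N (∑ m ∈ range n, (X : ℤ⟦X⟧) ^ G m) = eps N := by
  simp only [map_sum, coeff_X_pow, eps]
  split_ifs with hN
  · obtain ⟨m, rfl⟩ := hN
    have := G_strictMono.le_apply (x := m)
    simp only [G_strictMono.injective.eq_iff, sum_ite_eq]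
    rw [if_pos (mem_range.2 (by omega))]
  · exact sum_eq_zero fun m _ => if_neg fun hm => hN ⟨m, hm⟩

lemma coeff_distinct_mul_X_pow (N d : ℕ) :
    coeff N (PowerSeries.mk (fun n => Q n) * X ^ d) = Q ((N : ℤ) - d) := by
  rw [coeff_mul_X_pow']
  split_ifs with h
  · rw [coeff_mk, Nat.cast_sub h]
  · rw [Q, if_neg (by omega)]

theorem stmt_8 (n : ℕ) :
    Q (n : ℤ) + 2 * ∑' j : ℕ, (-1 : ℤ) ^ (j + 1) * Q ((n : ℤ) - 3 * ((j : ℤ) + 1) ^ 2) = eps n := by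
  obtain ⟨M, hM, h⟩ := X_pow_dvd_distinct_mul_theta_sub (n + 1)
  have h := X_pow_dvd_iff.1 h n (by omega)
  rw [map_sub, sub_eq_zero, theta_eq_sum_X_pow_G, coeff_sum_X_pow_G (by omega)] at h
  rw [← h, tsum_eq_sum (s := range M), mul_add, mul_one, map_add, coeff_mk, mul_sum, mul_sum,
    map_sum]
  · congr 1
    refine sum_congr rfl fun j _ => ?_
    rw [thetaTerm_neg_X_pow, mul_left_comm _ (C _), coeff_C_mul, coeff_distinct_mul_X_pow, mul_assoc]
    push_cast
    rfl
  · intro j hj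
    have : M ≤ j := by simpa using hj
    have : (n : ℤ) < j := by omega
    rw [Q, if_neg (by nlinarith), mul_zero]
end
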